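/- arXiv:2509.01207 — 3 statements merged into one kernel-verified Lean document; each statement's English description precedes it below -/
import Mathlib

section
/- Let L : [t₀, t₂) → Mₙ(ℂ) be a continuously differentiable solution of a matrix Riccati equation L' + L·A(t)·L + B(t)·L + L·C(t) + D(t) = 0 with A(t) Hermitian positive semidefinite, B(t) − C*(t) = μ(t)·I for a real-valued continuous function μ, and D(t) + D*(t) ≤ 0 (negative semidefinite) for all t. If L(t₀) + L*(t₀) > 0 (positive definite), then L(t) + L*(t) > 0 for all t ∈ [t₀, t₂). -/
open Matrix
open scoped ComplexOrder

namespace Matrix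

variable {ι : Type*} [Fintype ι]

/-- The real part of the sesquilinear form `x* X x`. -/
noncomputable def reForm (X : Matrix ι ι ℂ) (x : ι → ℂ) : ℝ := (star x ⬝ᵥ X *ᵥ x).re

lemma reForm_add (X Y : Matrix ι ι ℂ) (x : ι → ℂ) :
    reForm (X + Y) x = reForm X x + reForm Y x := by
  simp [reForm, add_mulVec]

lemma reForm_sub (X Y : Matrix ι ι ℂ) (x : ι → ℂ) :
    reForm (X - Y) x = reForm X x - reForm Y x := by
  simp [reForm, sub_mulVec]

lemma reForm_ofReal_smul (c : ℝ) (X : Matrix ι ι ℂ) (x : ι → ℂ) :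
    reForm ((c : ℂ) • X) x = c * reForm X x := by
  simp [reForm, smul_mulVec]

lemma reForm_ofReal_smul_vec (c : ℝ) (X : Matrix ι ι ℂ) (x : ι → ℂ) :
    reForm X ((c : ℂ) • x) = c ^ 2 * reForm X x := by
  simp [reForm, mulVec_smul, pow_two, mul_assoc]

lemma reForm_conjTranspose (X : Matrix ι ι ℂ) (x : ι → ℂ) : reForm Xᴴ x = reForm X x := by
  have h : star x ⬝ᵥ Xᴴ *ᵥ x = star (star x ⬝ᵥ X *ᵥ x) := by
    rw [dotProduct_mulVec, ← star_mulVec, star_dotProduct]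
  simp [reForm, h]

lemma continuous_reForm :
    Continuous fun p : Matrix ι ι ℂ × (ι → ℂ) => reForm p.1 p.2 :=
  Complex.continuous_re.comp
    (continuous_snd.star.dotProduct (continuous_fst.matrix_mulVec continuous_snd))

lemma continuousOn_reForm {M : ℝ → Matrix ι ι ℂ} {S : Set ℝ} (hM : ContinuousOn M S)
    (K : Set (ι → ℂ)) :
    ContinuousOn (fun p : ℝ × (ι → ℂ) => reForm (M p.1) p.2) (S ×ˢ K) := by
  have hfst : Set.MapsTo Prod.fst (S ×ˢ K) S := fun p hp => (Set.mem_prod.1 hp).1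
  have h : ContinuousOn (fun p : ℝ × (ι → ℂ) => M p.1) (S ×ˢ K) :=
    hM.comp continuousOn_fst hfst
  have h' : ContinuousOn (fun p : ℝ × (ι → ℂ) => (M p.1, p.2)) (S ×ˢ K) :=
    h.prodMk continuousOn_snd
  simpa only [Function.comp_def] using continuous_reForm.comp_continuousOn h'

lemma hasDerivAt_reForm {H : ℝ → Matrix ι ι ℂ} {H' : Matrix ι ι ℂ} {t : ℝ}
    (h : ∀ i j, HasDerivAt (fun s => H s i j) (H' i j) t) (x : ι → ℂ) :
    HasDerivAt (fun s => reForm (H s) x) (reForm H' x) t := by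
  have : HasDerivAt (fun s => star x ⬝ᵥ H s *ᵥ x) (star x ⬝ᵥ H' *ᵥ x) t := by
    simp only [dotProduct, mulVec]
    exact HasDerivAt.fun_sum fun i _ =>
      (HasDerivAt.fun_sum fun j _ => (h i j).mul_const (x j)).const_mul _
  exact Complex.reCLM.hasFDerivAt.comp_hasDerivAt t this

lemma PosSemidef.reForm_nonneg {X : Matrix ι ι ℂ} (h : X.PosSemidef) (x : ι → ℂ) :
    0 ≤ reForm X x :=
  (Complex.le_def.1 (h.dotProduct_mulVec_nonneg x)).1

lemma PosDef.reForm_pos {X : Matrix ι ι ℂ} (h : X.PosDef) {x : ι → ℂ} (hx : x ≠ 0) :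
    0 < reForm X x :=
  (Complex.lt_def.1 (h.dotProduct_mulVec_pos hx)).1

lemma IsHermitian.ofReal_reForm {X : Matrix ι ι ℂ} (h : X.IsHermitian) (x : ι → ℂ) :
    (reForm X x : ℂ) = star x ⬝ᵥ X *ᵥ x :=
  Complex.ext rfl (h.im_star_dotProduct_mulVec_self x).symm

/-- Every vector is a real multiple of a unit vector, so a sign condition on the unit sphere
determines semidefiniteness. -/
lemma IsHermitian.posSemidef_of_sphere {X : Matrix ι ι ℂ} (h : X.IsHermitian)
    (hX : ∀ x ∈ Metric.sphere (0 : ι → ℂ) 1, 0 ≤ reForm X x) : X.PosSemidef := by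
  refine .of_dotProduct_mulVec_nonneg h fun x => ?_
  rw [← h.ofReal_reForm, Complex.zero_le_real]
  by_cases hx : x = 0
  · simp [hx, reForm]
  have hn : ‖x‖ ≠ 0 := norm_ne_zero_iff.2 hx
  have hu := hX (((‖x‖⁻¹ : ℝ) : ℂ) • x) (by simp [norm_smul, hn])
  rw [reForm_ofReal_smul_vec] at hu
  exact nonneg_of_mul_nonneg_right hu (by positivity)

variable [DecidableEq ι]

lemma reForm_one_pos {x : ι → ℂ} (hx : x ≠ 0) : 0 < reForm 1 x :=
  PosDef.one.reForm_pos hx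

lemma PosDef.exists_reForm_sub_pos {X : Matrix ι ι ℂ} (h : X.PosDef) :
    ∃ ε : ℝ, 0 < ε ∧ ∀ x ∈ Metric.sphere (0 : ι → ℂ) 1,
      0 < reForm (X - (ε : ℂ) • (1 : Matrix ι ι ℂ)) x := by
  have hne : ∀ x ∈ Metric.sphere (0 : ι → ℂ) 1, x ≠ 0 := fun x hx =>
    ne_zero_of_mem_unit_sphere ⟨x, hx⟩
  have hc : ∀ Y : Matrix ι ι ℂ, Continuous (reForm Y) := fun Y =>
    continuous_reForm.comp (.prodMk_right Y)
  obtain ⟨c, hc0, hcle⟩ := (isCompact_sphere (0 : ι → ℂ) 1).exists_forall_le'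
    (f := fun x => reForm X x / reForm 1 x) (a := 0)
    ((hc X).continuousOn.div (hc 1).continuousOn fun x hx => (reForm_one_pos (hne x hx)).ne')
    fun x hx => div_pos (h.reForm_pos (hne x hx)) (reForm_one_pos (hne x hx))
  refine ⟨c / 2, half_pos hc0, fun x hx => ?_⟩
  have h1 := reForm_one_pos (hne x hx)
  have h2 := (le_div_iff₀ h1).1 (hcle x hx)
  rw [reForm_sub, reForm_ofReal_smul]
  nlinarith

/-- Positivity along a Lyapunov differential inequality `H' + N H + H N* ≥ 0` whose coefficient
has negative definite real part. -/
theorem posDef_of_lyapunov_of_neg {a b : ℝ} {H H' N : ℝ → Matrix ι ι ℂ}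
    (hH : ∀ t ∈ Set.Icc a b, (H t).IsHermitian)
    (hd : ∀ t ∈ Set.Icc a b, ∀ i j, HasDerivAt (fun s => H s i j) (H' t i j) t)
    (hP : ∀ t ∈ Set.Icc a b, (H' t + N t * H t + H t * (N t)ᴴ).PosSemidef)
    (hN : ∀ t ∈ Set.Icc a b, ∀ x ∈ Metric.sphere (0 : ι → ℂ) 1, reForm (N t) x < 0)
    (h0 : (H a).PosDef) :
    ∀ t ∈ Set.Icc a b, (H t).PosDef := by
  obtain ⟨ε, hε, hpos⟩ := h0.exists_reForm_sub_pos
  have hεH : ((ε : ℂ) • (1 : Matrix ι ι ℂ)).PosDef :=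
    PosDef.one.smul (Complex.zero_lt_real.2 hε)
  have hGH : ∀ t ∈ Set.Icc a b, (H t - (ε : ℂ) • (1 : Matrix ι ι ℂ)).IsHermitian :=
    fun t ht => (hH t ht).sub hεH.isHermitian
  have hHc : ContinuousOn H (Set.Icc a b) :=
    continuousOn_pi.2 fun i => continuousOn_pi.2 fun j t ht =>
      (hd t ht i j).continuousAt.continuousWithinAt
  suffices hG : ∀ t ∈ Set.Icc a b, ∀ x ∈ Metric.sphere (0 : ι → ℂ) 1,
      0 < reForm (H t - (ε : ℂ) • (1 : Matrix ι ι ℂ)) x by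
    intro t ht
    simpa using hεH.posSemidef_add ((hGH t ht).posSemidef_of_sphere fun x hx => (hG t ht x hx).le)
  set G : ℝ → Matrix ι ι ℂ := fun t => H t - (ε : ℂ) • (1 : Matrix ι ι ℂ) with hGdef
  have hGd : ∀ t ∈ Set.Icc a b, ∀ x, HasDerivAt (fun s => reForm (G s) x) (reForm (H' t) x) t :=
    fun t ht x => hasDerivAt_reForm (fun i j => (hd t ht i j).sub_const _) x
  have hcont : ContinuousOn (fun p : ℝ × (ι → ℂ) => reForm (G p.1) p.2)
      (Set.Icc a b ×ˢ Metric.sphere (0 : ι → ℂ) 1) :=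
    continuousOn_reForm (hHc.sub continuousOn_const) _
  have hK : IsCompact (Set.Icc a b ×ˢ Metric.sphere (0 : ι → ℂ) 1) :=
    isCompact_Icc.prod (isCompact_sphere _ _)
  by_contra! hbad
  obtain ⟨t₁, ht₁, x₁, hx₁, hle₁⟩ := hbad
  have hS : IsCompact ((Set.Icc a b ×ˢ Metric.sphere (0 : ι → ℂ) 1) ∩
      (fun p : ℝ × (ι → ℂ) => reForm (G p.1) p.2) ⁻¹' Set.Iic 0) :=
    hK.of_isClosed_subset (hcont.preimage_isClosed_of_isClosed hK.isClosed isClosed_Iic)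
      Set.inter_subset_left
  obtain ⟨⟨τ, x⟩, ⟨⟨hτ, hx⟩, hle⟩, hmin⟩ :=
    hS.exists_isMinOn ⟨(t₁, x₁), ⟨ht₁, hx₁⟩, hle₁⟩ continuous_fst.continuousOn
  simp only [Set.mem_preimage, Set.mem_Iic] at hτ hx hle
  have haτ : a < τ := by
    refine lt_of_le_of_ne hτ.1 fun h => ?_
    subst h
    exact (hpos x hx).not_ge hle
  have hbefore : ∀ s ∈ Set.Ioo a τ, ∀ y ∈ Metric.sphere (0 : ι → ℂ) 1, 0 < reForm (G s) y := by
    intro s hs y hy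
    by_contra! hsy
    have := hmin (a := (s, y)) ⟨⟨⟨hs.1.le, hs.2.le.trans hτ.2⟩, hy⟩, hsy⟩
    exact hs.2.not_ge this
  have hnear : Set.Ioo a τ ∈ nhdsWithin τ (Set.Iio τ) := Ioo_mem_nhdsLT haτ
  have hpsd : (G τ).PosSemidef := by
    refine (hGH τ hτ).posSemidef_of_sphere fun y hy => ?_
    have hlim : Filter.Tendsto (fun s => reForm (G s) y) (nhdsWithin τ (Set.Iio τ))
        (nhds (reForm (G τ) y)) :=
      (hGd τ hτ y).continuousAt.tendsto.mono_left nhdsWithin_le_nhds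
    refine ge_of_tendsto hlim ?_
    filter_upwards [hnear] with s hs using (hbefore s hs y hy).le
  have hzero : reForm (G τ) x = 0 := le_antisymm hle (hpsd.reForm_nonneg x)
  have hker : H τ *ᵥ x = (ε : ℂ) • x := by
    have h1 : G τ *ᵥ x = 0 := (hpsd.dotProduct_mulVec_zero_iff x).1 (by
      rw [← hpsd.isHermitian.ofReal_reForm, hzero, Complex.ofReal_zero])
    rw [hGdef, sub_mulVec, smul_mulVec, one_mulVec] at h1
    exact sub_eq_zero.1 h1
  have hNH : reForm (N τ * H τ) x = ε * reForm (N τ) x := by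
    simp [reForm, ← mulVec_mulVec, hker, mulVec_smul]
  have hHN : reForm (H τ * (N τ)ᴴ) x = ε * reForm (N τ) x := by
    rw [← hNH, ← reForm_conjTranspose (N τ * H τ), conjTranspose_mul, (hH τ hτ).eq]
  have hderiv : reForm (H' τ) x ≤ 0 := by
    refine le_of_tendsto ((hasDerivWithinAt_iff_tendsto_slope' (s := Set.Iio τ)
      (lt_irrefl τ)).1 (hGd τ hτ x).hasDerivWithinAt) ?_
    filter_upwards [hnear] with s hs
    rw [slope_def_field, hzero, sub_zero]
    exact div_nonpos_of_nonneg_of_nonpos (hbefore s hs x hx).le (sub_nonpos.2 hs.2.le)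
  have hsum := (hP τ hτ).reForm_nonneg x
  rw [reForm_add, reForm_add, hNH, hHN] at hsum
  nlinarith [hN τ hτ x hx]

/-- Positive definiteness propagates along a Lyapunov differential inequality
`H' + M H + H M* ≥ 0` with continuous coefficient. -/
theorem posDef_of_lyapunov {a b : ℝ} {H H' M : ℝ → Matrix ι ι ℂ}
    (hH : ∀ t ∈ Set.Icc a b, (H t).IsHermitian)
    (hd : ∀ t ∈ Set.Icc a b, ∀ i j, HasDerivAt (fun s => H s i j) (H' t i j) t)
    (hM : ContinuousOn M (Set.Icc a b))
    (hP : ∀ t ∈ Set.Icc a b, (H' t + M t * H t + H t * (M t)ᴴ).PosSemidef)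
    (h0 : (H a).PosDef) :
    ∀ t ∈ Set.Icc a b, (H t).PosDef := by
  have hne : ∀ x ∈ Metric.sphere (0 : ι → ℂ) 1, x ≠ 0 := fun x hx =>
    ne_zero_of_mem_unit_sphere ⟨x, hx⟩
  obtain ⟨k, hk⟩ : ∃ k : ℝ, ∀ t ∈ Set.Icc a b, ∀ x ∈ Metric.sphere (0 : ι → ℂ) 1,
      reForm (M t - (k : ℂ) • (1 : Matrix ι ι ℂ)) x < 0 := by
    have hcont : ContinuousOn (fun p : ℝ × (ι → ℂ) => reForm (M p.1) p.2 / reForm 1 p.2)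
        (Set.Icc a b ×ˢ Metric.sphere (0 : ι → ℂ) 1) :=
      (continuousOn_reForm hM _).div (continuousOn_reForm continuousOn_const _) fun p hp => (reForm_one_pos (hne _ hp.2)).ne'
    obtain ⟨k, hk⟩ := (isCompact_Icc.prod (isCompact_sphere _ _)).bddAbove_image hcont
    refine ⟨k + 1, fun t ht x hx => ?_⟩
    have h1 := reForm_one_pos (hne x hx)
    have h2 := (div_le_iff₀ h1).1 (hk ⟨(t, x), ⟨ht, hx⟩, rfl⟩)
    rw [reForm_sub, reForm_ofReal_smul]
    nlinarith
  have hexp : ∀ t : ℝ, HasDerivAt (fun s : ℝ => ((Real.exp (2 * k * s) : ℝ) : ℂ))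
      ((Real.exp (2 * k * t) * (2 * k) : ℝ) : ℂ) t := fun t =>
    (((hasDerivAt_id t).const_mul (2 * k)).exp.congr_deriv (by simp)).ofReal_comp
  have hpos : ∀ t : ℝ, 0 < ((Real.exp (2 * k * t) : ℝ) : ℂ) := fun t =>
    Complex.zero_lt_real.2 (Real.exp_pos _)
  have key := posDef_of_lyapunov_of_neg (a := a) (b := b)
    (H := fun t => ((Real.exp (2 * k * t) : ℝ) : ℂ) • H t)
    (H' := fun t => ((Real.exp (2 * k * t) * (2 * k) : ℝ) : ℂ) • H t +
      ((Real.exp (2 * k * t) : ℝ) : ℂ) • H' t)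
    (N := fun t => M t - (k : ℂ) • (1 : Matrix ι ι ℂ))
    (fun t ht => by
      simp only [IsHermitian, conjTranspose_smul, (hH t ht).eq, Complex.star_def,
        Complex.conj_ofReal])
    (fun t ht i j => (hexp t).mul (hd t ht i j))
    (fun t ht => by
      convert (hP t ht).smul (hpos t).le using 1
      simp only [conjTranspose_sub, conjTranspose_smul, conjTranspose_one, Complex.star_def,
        Complex.conj_ofReal, sub_mul, mul_sub, smul_mul_assoc, mul_smul_comm, one_mul, mul_one]
      push_cast
      module)
    hk (h0.smul (hpos a))
  intro t ht
  have := (key t ht).smul (inv_pos.2 (hpos t))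
  simpa [smul_smul, (hpos t).ne'] using this

end Matrix

/-- Positivity of `L + L*` is preserved for solutions of
`L' + L A L + B L + L C + D = 0` with `A ≥ 0`, `B - C* = μ I`, `D + D* ≤ 0`. -/
theorem hermitian_part_stays_posDef (n : ℕ) (t₀ t₂ : ℝ)
    (A B C D L : ℝ → Matrix (Fin n) (Fin n) ℂ) (μ : ℝ → ℝ)
    (hA : ContinuousOn A (Set.Ico t₀ t₂)) (hB : ContinuousOn B (Set.Ico t₀ t₂))
    (hC : ContinuousOn C (Set.Ico t₀ t₂)) (hD : ContinuousOn D (Set.Ico t₀ t₂))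
    (hμ : ContinuousOn μ (Set.Ico t₀ t₂))
    (hApos : ∀ t ∈ Set.Ico t₀ t₂, (A t).PosSemidef)
    (hBC : ∀ t ∈ Set.Ico t₀ t₂,
      B t - (C t)ᴴ = (μ t : ℂ) • (1 : Matrix (Fin n) (Fin n) ℂ))
    (hDneg : ∀ t ∈ Set.Ico t₀ t₂, (-(D t + (D t)ᴴ)).PosSemidef)
    (hL : ∀ t ∈ Set.Ico t₀ t₂, ∀ i j,
      HasDerivAt (fun s => L s i j)
        ((-(L t * A t * L t + B t * L t + L t * C t + D t)) i j) t)
    (hLcont : ∀ i j, ContinuousOn (fun t => L t i j) (Set.Ico t₀ t₂))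
    (h0 : (L t₀ + (L t₀)ᴴ).PosDef) :
    ∀ t ∈ Set.Ico t₀ t₂, (L t + (L t)ᴴ).PosDef := by
  intro T hT
  have hsub : Set.Icc t₀ T ⊆ Set.Ico t₀ t₂ := fun s hs => ⟨hs.1, hs.2.trans_lt hT.2⟩
  have hLc : ContinuousOn L (Set.Icc t₀ T) :=
    continuousOn_pi.2 fun i => continuousOn_pi.2 fun j => (hLcont i j).mono hsub
  refine posDef_of_lyapunov (a := t₀) (b := T) (H := fun t => L t + (L t)ᴴ)
    (H' := fun t => -(L t * A t * L t + B t * L t + L t * C t + D t) +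
      (-(L t * A t * L t + B t * L t + L t * C t + D t))ᴴ)
    (M := fun t => (4⁻¹ : ℂ) • ((L t + (L t)ᴴ) * A t) + (C t)ᴴ +
      (((μ t / 2 : ℝ) : ℂ)) • (1 : Matrix (Fin n) (Fin n) ℂ))
    (fun t _ => isHermitian_add_transpose_self (L t))
    (fun t ht i j => (hL t (hsub ht) i j).add (hL t (hsub ht) j i).star)
    ?_ (fun t ht => ?_) h0 T ⟨hT.1, le_rfl⟩
  · have hA' := hA.mono hsub
    have hC' := hC.mono hsub
    have hμ' := hμ.mono hsub
    have hLs : ContinuousOn (fun t => (L t)ᴴ) (Set.Icc t₀ T) :=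
      (continuous_id.matrix_conjTranspose).comp_continuousOn hLc
    have hCs : ContinuousOn (fun t => (C t)ᴴ) (Set.Icc t₀ T) :=
      (continuous_id.matrix_conjTranspose).comp_continuousOn hC'
    have hμc : ContinuousOn (fun t => ((μ t / 2 : ℝ) : ℂ)) (Set.Icc t₀ T) :=
      Complex.continuous_ofReal.comp_continuousOn (hμ'.div_const 2)
    exact ((((hLc.add hLs).mul hA').const_smul (4⁻¹ : ℂ)).add hCs).add
      (hμc.smul continuousOn_const)
  · have hAt := hApos t (hsub ht)
    have hB' : B t = (C t)ᴴ + (μ t : ℂ) • (1 : Matrix (Fin n) (Fin n) ℂ) :=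
      sub_eq_iff_eq_add'.1 (hBC t (hsub ht))
    have hK := ((hAt.mul_mul_conjTranspose_same (L t - (L t)ᴴ)).smul
      (a := (2⁻¹ : ℂ)) (by positivity)).add (hDneg t (hsub ht))
    convert hK using 1
    rw [hB']
    simp only [conjTranspose_add, conjTranspose_sub, conjTranspose_neg, conjTranspose_smul,
      conjTranspose_mul, conjTranspose_one, conjTranspose_conjTranspose, hAt.isHermitian.eq,
      Complex.star_def, Complex.conj_ofReal, map_inv₀, map_ofNat, add_mul, mul_add, sub_mul,
      mul_sub, smul_mul_assoc, mul_smul_comm, one_mul, mul_one, smul_add, smul_sub, mul_assoc]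
    push_cast
    module
end

section
/- Let P, Q, R, S : [t₀,∞) → Mₙ(ℂ) be continuous with P(t) Hermitian positive semidefinite, and let Z : [t₀, t₁) → Mₙ(ℂ) (t₁ < ∞) be a solution of the Riccati equation Z' + ZPZ + QZ + ZR + S = 0 such that Z(t) + Z*(t) ≥ 0 on [t₀, t₁). Then Z extends to a solution on [t₀, t₁ + ε) for some ε > 0; i.e., [t₀, t₁) is not a maximal interval of existence. -/
open Matrix
open scoped ComplexOrder

section Trace

open scoped MatrixOrder Matrix.Norms.L2Operator

theorem Matrix.PosSemidef.re_trace_mul_nonneg {n : Type*} [Fintype n] {P Z : Matrix n n ℂ}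
    (hP : P.PosSemidef) (hZ : (Z + Zᴴ).PosSemidef) : 0 ≤ (P * Z).trace.re := by
  classical
  obtain ⟨B, rfl⟩ := CStarAlgebra.nonneg_iff_eq_star_mul_self.mp hP.nonneg
  rw [star_eq_conjTranspose]
  have h := (Complex.nonneg_iff.1 (hZ.mul_mul_conjTranspose_same B).trace_nonneg).1
  have h1 : (B * Z * Bᴴ).trace = (Bᴴ * B * Z).trace := by
    rw [trace_mul_comm, ← Matrix.mul_assoc]
  have h2 : (B * Zᴴ * Bᴴ).trace = star (Bᴴ * B * Z).trace := by
    rw [← h1, ← trace_conjTranspose]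
    simp [Matrix.mul_assoc]
  rw [Matrix.mul_add, Matrix.add_mul, trace_add, h1, h2] at h
  simp at h
  linarith

end Trace

section Riccati

open scoped Matrix.Norms.Operator

section LinearODE

variable {E : Type*} [NormedAddCommGroup E] [NormedSpace ℝ E] [CompleteSpace E]

theorem exists_hasDerivAt_linear_of_norm_le {A : ℝ → E →L[ℝ] E} {K s h : ℝ} (hK : 0 ≤ K)
    (hh : 0 < h) (hKh : K * (2 * h) ≤ 1)
    (hA : ContinuousOn A (Set.Icc (s - h) (s + h)))
    (hAK : ∀ t ∈ Set.Icc (s - h) (s + h), ‖A t‖ ≤ K) (x : E) :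
    ∃ α : ℝ → E, α s = x ∧
      ∀ t ∈ Set.Ioo (s - h) (s + h), HasDerivAt α (A t (α t)) t := by
  lift K to NNReal using hK
  have hpl : IsPicardLindelof (fun t y => A t y) (tmin := s - h) (tmax := s + h)
      ⟨s, by constructor <;> linarith⟩ x ‖x‖₊ 0 (K * (2 * ‖x‖₊)) K := by
    refine ⟨fun t ht => ?_, fun y _ => hA.clm_apply continuousOn_const, fun t ht y hy => ?_, ?_⟩
    · exact ((A t).lipschitz.weaken (by exact_mod_cast hAK t ht)).lipschitzOnWith
    · have hy' : ‖y‖ ≤ 2 * ‖x‖ := by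
        have h1 : ‖y - x‖ ≤ ‖x‖ := by simpa [dist_eq_norm] using hy
        linarith [norm_le_norm_add_norm_sub' y x]
      calc ‖A t y‖ ≤ ‖A t‖ * ‖y‖ := (A t).le_opNorm y
        _ ≤ K * (2 * ‖x‖) := by gcongr; exact hAK t ht
        _ = _ := by simp
    · have hmax : max (s + h - s) (s - (s - h)) = h := by simp
      simp only [hmax]
      push_cast
      simp only [sub_zero]
      nlinarith [norm_nonneg x]
  obtain ⟨α, hα, hα'⟩ := hpl.exists_eq_forall_mem_Icc_hasDerivWithinAt₀
  exact ⟨α, hα, fun t ht =>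
    (hα' t (Set.Ioo_subset_Icc_self ht)).hasDerivAt (Icc_mem_nhds ht.1 ht.2)⟩

/-- The linear system associated with the Riccati equation is solvable on intervals whose length
does not depend on their position. -/
theorem exists_hasDerivAt_linear_system {𝔸 : Type*} [NormedRing 𝔸] [NormedAlgebra ℝ 𝔸]
    [CompleteSpace 𝔸] {P Q R S : ℝ → 𝔸} {a b : ℝ}
    (hP : ContinuousOn P (Set.Icc a b)) (hQ : ContinuousOn Q (Set.Icc a b))
    (hR : ContinuousOn R (Set.Icc a b)) (hS : ContinuousOn S (Set.Icc a b)) :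
    ∃ η > 0, ∀ h, 0 < h → h ≤ η → ∀ s, Set.Icc (s - h) (s + h) ⊆ Set.Icc a b → ∀ x y : 𝔸,
      ∃ Φ Ψ : ℝ → 𝔸, Φ s = x ∧ Ψ s = y ∧
        (∀ t ∈ Set.Ioo (s - h) (s + h), HasDerivAt Φ (R t * Φ t + P t * Ψ t) t) ∧
        ∀ t ∈ Set.Ioo (s - h) (s + h), HasDerivAt Ψ (-(S t * Φ t + Q t * Ψ t)) t := by
  let mulL := ContinuousLinearMap.mul ℝ 𝔸
  let fstL := ContinuousLinearMap.fst ℝ 𝔸 𝔸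
  let sndL := ContinuousLinearMap.snd ℝ 𝔸 𝔸
  let A : ℝ → (𝔸 × 𝔸 →L[ℝ] 𝔸 × 𝔸) := fun t =>
    (ContinuousLinearMap.inl ℝ 𝔸 𝔸).comp ((mulL (R t)).comp fstL + (mulL (P t)).comp sndL) +
      (ContinuousLinearMap.inr ℝ 𝔸 𝔸).comp
        (-((mulL (S t)).comp fstL + (mulL (Q t)).comp sndL))
  have hA : ContinuousOn A (Set.Icc a b) := by
    unfold A
    fun_prop
  obtain ⟨K, hK⟩ := isCompact_Icc.exists_bound_of_continuousOn (f := A) hA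
  refine ⟨1 / (2 * (|K| + 1)), by positivity, fun h hh hhη s hs x y => ?_⟩
  have hKh : |K| * (2 * h) ≤ 1 := by
    calc |K| * (2 * h) ≤ |K| * (2 * (1 / (2 * (|K| + 1)))) := by gcongr
      _ ≤ 1 := by
        field_simp
        linarith
  obtain ⟨α, hαs, hα⟩ := exists_hasDerivAt_linear_of_norm_le (abs_nonneg K) hh hKh
    (hA.mono hs) (fun t ht => (hK t (hs ht)).trans (le_abs_self K)) (x, y)
  refine ⟨fun t => (α t).1, fun t => (α t).2, by simp [hαs], by simp [hαs],
    fun t ht => ?_, fun t ht => ?_⟩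
  · refine (fstL.hasFDerivAt.comp_hasDerivAt t (hα t ht)).congr_deriv ?_
    simp [A, mulL, fstL, sndL]
  · refine (sndL.hasFDerivAt.comp_hasDerivAt t (hα t ht)).congr_deriv ?_
    simp [A, mulL, fstL, sndL]

end LinearODE

namespace Matrix

variable {n : Type*} [Fintype n]

theorem hasDerivAt_iff {M : ℝ → Matrix n n ℂ} {M' : Matrix n n ℂ} {t : ℝ} :
    HasDerivAt M M' t ↔ ∀ i j, HasDerivAt (fun s => M s i j) (M' i j) t := by
  exact (hasDerivAt_pi (φ := M) (φ' := M')).trans (forall_congr' fun i => hasDerivAt_pi)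

variable [DecidableEq n]

/-- Jacobi's formula along a linear system. -/
theorem hasDerivAt_det_of_hasDerivAt_mul {Φ : ℝ → Matrix n n ℂ} {A : Matrix n n ℂ} {t : ℝ}
    (h : HasDerivAt Φ (A * Φ t) t) :
    HasDerivAt (fun s => (Φ s).det) (A.trace * (Φ t).det) t := by
  let D : ContinuousMultilinearMap ℝ (fun _ : n => n → ℂ) ℂ :=
    ⟨(detRowAlternating (n := n) (R := ℂ)).toMultilinearMap.restrictScalars ℝ,
      (continuous_id.matrix_det : Continuous (det : Matrix n n ℂ → ℂ))⟩
  have hpi : HasDerivAt (F := n → n → ℂ) Φ (A * Φ t) t := h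
  have hD := (D.hasFDerivAt (Φ t)).comp_hasDerivAt t hpi
  refine hD.congr_deriv ?_
  refine (ContinuousMultilinearMap.linearDeriv_apply D (Φ t) (A * Φ t)).trans ?_
  rw [trace, Finset.sum_mul]
  refine Finset.sum_congr rfl fun i _ => ?_
  have hrow : (A * Φ t) i = ∑ k, A i k • Φ t k := by
    ext j; simp [mul_apply]
  have hdet := det_updateRow_sum (Φ t) i (A i)
  rw [← hrow] at hdet
  exact hdet

/-- By Liouville's formula, a fundamental matrix of `Φ' = A Φ` stays invertible as long as the
real part of the trace of `A` is bounded below. -/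
theorem det_ne_zero_of_neg_le_re_trace {Φ A : ℝ → Matrix n n ℂ} {a b C : ℝ}
    (hΦ : ContinuousOn Φ (Set.Icc a b))
    (hΦ' : ∀ t ∈ Set.Ioo a b, HasDerivAt Φ (A t * Φ t) t)
    (hA : ∀ t ∈ Set.Ioo a b, -C ≤ (A t).trace.re) (ha : (Φ a).det ≠ 0) :
    ∀ t ∈ Set.Icc a b, (Φ t).det ≠ 0 := by
  have hexp (t : ℝ) :
      HasDerivAt (fun s => Real.exp (2 * C * s)) (Real.exp (2 * C * t) * (2 * C)) t := by
    simpa using ((hasDerivAt_id t).const_mul (2 * C)).exp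
  have hderiv : ∀ t ∈ Set.Ioo a b, HasDerivAt (fun s => Real.exp (2 * C * s) * ‖(Φ s).det‖ ^ 2)
      (2 * (C + (A t).trace.re) * (Real.exp (2 * C * t) * ‖(Φ t).det‖ ^ 2)) t := by
    intro t ht
    refine ((hexp t).mul (hasDerivAt_det_of_hasDerivAt_mul (hΦ' t ht)).norm_sq).congr_deriv ?_
    simp only [Complex.inner]
    rw [mul_assoc (A t).trace, Complex.mul_conj, Complex.normSq_eq_norm_sq, Complex.re_mul_ofReal]
    ring
  have hmono : MonotoneOn (fun s => Real.exp (2 * C * s) * ‖(Φ s).det‖ ^ 2) (Set.Icc a b) := by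
    refine monotoneOn_of_hasDerivWithinAt_nonneg (convex_Icc a b) ?_
      (fun t ht => (hderiv t (by simpa using ht)).hasDerivWithinAt) ?_
    · have : ContinuousOn (fun s => (Φ s).det) (Set.Icc a b) :=
        (continuous_id.matrix_det : Continuous (det : Matrix n n ℂ → ℂ)).comp_continuousOn hΦ
      fun_prop
    · intro t ht
      rw [interior_Icc] at ht
      have := hA t ht
      have : 0 ≤ C + (A t).trace.re := by linarith
      positivity
  intro t ht h0
  have hle := hmono ⟨le_rfl, ht.1.trans ht.2⟩ ht ht.1
  have hpos : 0 < Real.exp (2 * C * a) * ‖(Φ a).det‖ ^ 2 := by positivity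
  exact hpos.not_ge (by simpa [h0] using hle)

theorem hasDerivAt_mul_inv {Φ Ψ : ℝ → Matrix n n ℂ} {P Q R S : Matrix n n ℂ} {t : ℝ}
    (hΦ : HasDerivAt Φ (R * Φ t + P * Ψ t) t) (hΨ : HasDerivAt Ψ (-(S * Φ t + Q * Ψ t)) t)
    (hdet : (Φ t).det ≠ 0) :
    HasDerivAt (fun s => Ψ s * (Φ s)⁻¹)
      (-((Ψ t * (Φ t)⁻¹) * P * (Ψ t * (Φ t)⁻¹) + Q * (Ψ t * (Φ t)⁻¹)
        + (Ψ t * (Φ t)⁻¹) * R + S)) t := by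
  have hu : IsUnit (Φ t).det := hdet.isUnit
  obtain ⟨u, hu'⟩ := (isUnit_iff_isUnit_det _).2 hu
  have hinv : HasDerivAt (fun s => (Φ s)⁻¹)
      (-((Φ t)⁻¹ * (R * Φ t + P * Ψ t) * (Φ t)⁻¹)) t := by
    have h := hasFDerivAt_ringInverse (𝕜 := ℝ) u
    rw [hu'] at h
    have h' := h.comp_hasDerivAt t hΦ
    simp only [nonsing_inv_eq_ringInverse]
    refine h'.congr_deriv ?_
    simp [← hu']
  refine (hΨ.mul hinv).congr_deriv ?_
  have h1 : Φ t * (Φ t)⁻¹ = 1 := mul_nonsing_inv _ hu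
  have e1 : ∀ M : Matrix n n ℂ, M * Φ t * (Φ t)⁻¹ = M := fun M => by
    rw [Matrix.mul_assoc, h1, Matrix.mul_one]
  simp only [Matrix.mul_add, Matrix.add_mul, Matrix.neg_mul, Matrix.mul_neg, ← Matrix.mul_assoc, e1]
  abel

end Matrix

/-- A solution of a matrix Riccati equation with `P ≥ 0` and `Z + Z* ≥ 0` extends to the right.
The linearizing fundamental matrix stays invertible by Liouville's formula. -/
theorem riccati_extension_of_hasDerivAt (n : ℕ) (t₀ t₁ : ℝ) (ht : t₀ < t₁)
    (P Q R S Z : ℝ → Matrix (Fin n) (Fin n) ℂ)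
    (hP : ContinuousOn P (Set.Ici t₀)) (hQ : ContinuousOn Q (Set.Ici t₀))
    (hR : ContinuousOn R (Set.Ici t₀)) (hS : ContinuousOn S (Set.Ici t₀))
    (hPpos : ∀ t, t₀ ≤ t → (P t).PosSemidef)
    (hZ : ∀ t ∈ Set.Ico t₀ t₁, HasDerivAt Z
        (-(Z t * P t * Z t + Q t * Z t + Z t * R t + S t)) t)
    (hZpos : ∀ t ∈ Set.Ico t₀ t₁, (Z t + (Z t)ᴴ).PosSemidef) :
    ∃ ε > 0, ∃ W : ℝ → Matrix (Fin n) (Fin n) ℂ,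
      (∀ t ∈ Set.Ico t₀ t₁, W t = Z t) ∧
      ∀ t ∈ Set.Ico t₀ (t₁ + ε), HasDerivAt W
          (-(W t * P t * W t + Q t * W t + W t * R t + S t)) t := by
  let M := Matrix (Fin n) (Fin n) ℂ
  have hsub : Set.Icc t₀ (t₁ + 1) ⊆ Set.Ici t₀ := Set.Icc_subset_Ici_self
  obtain ⟨η, hη, hsystem⟩ := exists_hasDerivAt_linear_system
    (hP.mono hsub) (hQ.mono hsub) (hR.mono hsub) (hS.mono hsub)
  have htr : ContinuousOn (fun t => (R t).trace) (Set.Ici t₀) :=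
    (continuous_id.matrix_trace : Continuous (trace : M → ℂ)).comp_continuousOn hR
  obtain ⟨C, hC⟩ := isCompact_Icc.exists_bound_of_continuousOn (htr.mono hsub)
  obtain ⟨h, hh, hh1, hht, hhη⟩ : ∃ h : ℝ, 0 < h ∧ h ≤ 1 ∧ h ≤ (t₁ - t₀) / 2 ∧ h ≤ η :=
    ⟨min (min 1 ((t₁ - t₀) / 2)) η, lt_min (lt_min one_pos (by linarith)) hη,
      (min_le_left _ _).trans (min_le_left _ _), (min_le_left _ _).trans (min_le_right _ _),
      min_le_right _ _⟩
  obtain ⟨s, hs⟩ : ∃ s, s = t₁ - h / 2 := ⟨_, rfl⟩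
  have hsI : Set.Icc (s - h) (s + h) ⊆ Set.Icc t₀ (t₁ + 1) :=
    Set.Icc_subset_Icc (by linarith) (by linarith)
  obtain ⟨Φ, Ψ, hΦs, hΨs, hΦ', hΨ'⟩ := hsystem h hh hhη s hsI 1 (Z s)
  have hI : Set.Ico s t₁ ⊆ Set.Ioo (s - h) (s + h) :=
    fun t ht => ⟨by linarith [ht.1], by linarith [ht.2]⟩
  have hI0 : Set.Ico s t₁ ⊆ Set.Ico t₀ t₁ := Set.Ico_subset_Ico_left (by linarith)
  have hΨZ : ∀ t ∈ Set.Ico s t₁, Ψ t = Z t * Φ t := by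
    intro b hb
    have hIb : Set.Icc s b ⊆ Set.Ico s t₁ := Set.Icc_subset_Ico_right hb.2
    have hD : ∀ t ∈ Set.Ico s t₁, HasDerivAt (fun t => Ψ t - Z t * Φ t)
        (-(Q t + Z t * P t) * (Ψ t - Z t * Φ t)) t := by
      intro t ht
      refine ((hΨ' t (hI ht)).sub ((hZ t (hI0 ht)).mul (hΦ' t (hI ht)))).congr_deriv ?_
      noncomm_ring
    have hZc : ContinuousOn Z (Set.Icc s b) :=
      fun t ht => (hZ t (hI0 (hIb ht))).continuousAt.continuousWithinAt
    have hIbt : Set.Icc s b ⊆ Set.Ici t₀ := fun t ht => (hI0 (hIb ht)).1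
    obtain ⟨B, hB⟩ := isCompact_Icc.exists_bound_of_continuousOn
      ((hQ.mono hIbt).add (hZc.mul (hP.mono hIbt))).neg
    have := eq_zero_of_abs_deriv_le_mul_abs_self_of_eq_zero_right
      (fun t ht => (hD t (hIb ht)).continuousAt.continuousWithinAt)
      (fun t ht => (hD t (hIb (Set.Ico_subset_Icc_self ht))).hasDerivWithinAt)
      (by simp [hΦs, hΨs])
      (fun t ht => (norm_mul_le _ _).trans
        (mul_le_mul_of_nonneg_right (hB t (Set.Ico_subset_Icc_self ht)) (norm_nonneg _)))
      b ⟨hb.1, le_rfl⟩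
    exact sub_eq_zero.1 this
  have hI1 : Set.Icc s t₁ ⊆ Set.Ioo (s - h) (s + h) :=
    fun t ht => ⟨by linarith [ht.1], by linarith [ht.2]⟩
  have hdet : ∀ t ∈ Set.Icc s t₁, (Φ t).det ≠ 0 := by
    refine det_ne_zero_of_neg_le_re_trace (A := fun t => R t + P t * Z t) (C := C)
      (fun t ht => (hΦ' t (hI1 ht)).continuousAt.continuousWithinAt) (fun t ht => ?_)
      (fun t ht => ?_) (by simp [hΦs])
    · have ht' := Set.Ioo_subset_Ico_self ht
      refine (hΦ' t (hI ht')).congr_deriv ?_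
      rw [hΨZ t ht', add_mul, mul_assoc]
    · have ht' := hI0 (Set.Ioo_subset_Ico_self ht)
      have h1 := (hPpos t ht'.1).re_trace_mul_nonneg (hZpos t ht')
      have h2 := (Complex.abs_re_le_norm _).trans (hC t ⟨ht'.1, by linarith [ht'.2]⟩)
      rw [trace_add, Complex.add_re]
      linarith [(abs_le.1 h2).1]
  have ht₁ : t₁ ∈ Set.Icc s t₁ := ⟨by linarith, le_rfl⟩
  have hdet_cont : ContinuousAt (fun t => (Φ t).det) t₁ :=
    (continuous_id.matrix_det : Continuous (det : M → ℂ)).continuousAt.comp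
      (hΦ' t₁ (hI1 ht₁)).continuousAt
  obtain ⟨δ, hδ, hδdet⟩ := Metric.eventually_nhds_iff.1 (hdet_cont.eventually_ne (hdet t₁ ht₁))
  have hWZ : ∀ t ∈ Set.Ico s t₁, Ψ t * (Φ t)⁻¹ = Z t := fun t ht => by
    rw [hΨZ t ht, mul_assoc, mul_nonsing_inv _ (hdet t (Set.Ico_subset_Icc_self ht)).isUnit,
      mul_one]
  refine ⟨min δ (h / 2), lt_min hδ (by linarith),
    fun t => if t < t₁ then Z t else Ψ t * (Φ t)⁻¹, fun t ht => if_pos ht.2, fun t ht => ?_⟩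
  rcases lt_or_ge t t₁ with hlt | hge
  · simp only [if_pos hlt]
    refine (hZ t ⟨ht.1, hlt⟩).congr_of_eventuallyEq ?_
    filter_upwards [Iio_mem_nhds hlt] with u hu using if_pos hu
  · simp only [if_neg hge.not_gt]
    have htδ : t < t₁ + δ := ht.2.trans_le (by gcongr; exact min_le_left _ _)
    have hth : t < t₁ + h / 2 := ht.2.trans_le (by gcongr; exact min_le_right _ _)
    have htI : t ∈ Set.Ioo (s - h) (s + h) := ⟨by linarith, by linarith⟩
    have hdt : (Φ t).det ≠ 0 := hδdet (by rw [Real.dist_eq, abs_lt]; constructor <;> linarith)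
    refine (hasDerivAt_mul_inv (hΦ' t htI) (hΨ' t htI) hdt).congr_of_eventuallyEq ?_
    filter_upwards [Ioi_mem_nhds (show s < t by linarith)] with u hu
    split_ifs with hut
    · exact (hWZ u ⟨le_of_lt hu, hut⟩).symm
    · rfl

end Riccati

/-- If `Z` solves the Riccati equation on `[t₀, t₁)` with `P ≥ 0` Hermitian and
`Z + Z* ≥ 0`, then `Z` extends as a solution to `[t₀, t₁ + ε)` for some `ε > 0`. -/
theorem riccati_extension (n : ℕ) (t₀ t₁ : ℝ) (ht : t₀ < t₁)
    (P Q R S Z : ℝ → Matrix (Fin n) (Fin n) ℂ)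
    (hP : ContinuousOn P (Set.Ici t₀)) (hQ : ContinuousOn Q (Set.Ici t₀))
    (hR : ContinuousOn R (Set.Ici t₀)) (hS : ContinuousOn S (Set.Ici t₀))
    (hPpos : ∀ t, t₀ ≤ t → (P t).PosSemidef)
    (hZ : ∀ t ∈ Set.Ico t₀ t₁, ∀ i j,
      HasDerivAt (fun s => Z s i j)
        ((-(Z t * P t * Z t + Q t * Z t + Z t * R t + S t)) i j) t)
    (hZpos : ∀ t ∈ Set.Ico t₀ t₁, (Z t + (Z t)ᴴ).PosSemidef) :
    ∃ ε > 0, ∃ W : ℝ → Matrix (Fin n) (Fin n) ℂ,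
      (∀ t ∈ Set.Ico t₀ t₁, W t = Z t) ∧
      ∀ t ∈ Set.Ico t₀ (t₁ + ε), ∀ i j,
        HasDerivAt (fun s => W s i j)
          ((-(W t * P t * W t + Q t * W t + W t * R t + S t)) i j) t := by
  obtain ⟨ε, hε, W, hWZ, hW⟩ := riccati_extension_of_hasDerivAt n t₀ t₁ ht P Q R S Z hP hQ hR hS
    hPpos (fun t ht => Matrix.hasDerivAt_iff.2 (hZ t ht)) hZpos
  exact ⟨ε, hε, W, hWZ, fun t ht => Matrix.hasDerivAt_iff.1 (hW t ht)⟩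
end

section
/- Suppose P, Q, S : [t₀,∞) → Mₙ(ℂ) are continuous with P(t) Hermitian positive semidefinite and S(t) Hermitian negative semidefinite, and set R(t) = Q*(t). Then every solution Z of Z' + ZP(t)Z + Q(t)Z + ZQ*(t) + S(t) = 0 with Z(t₀) Hermitian positive semidefinite exists on all of [t₀,∞) and satisfies Z(t) Hermitian and Z(t) ≥ 0 for all t ≥ t₀. -/
open Matrix
open scoped ComplexOrder

open Set Filter Topology intervalIntegral
open scoped BoundedContinuousFunction

section LinearODE

variable {E : Type*} [NormedAddCommGroup E] [NormedSpace ℝ E]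

/-- The weight `exp (-2 m)`, with `m` a primitive of `‖A‖`, makes the integral operator of a linear
differential equation a contraction with constant `1 / 2`. -/
theorem exp_neg_mul_norm_integral_le {A : ℝ → E →L[ℝ] E} {m : ℝ → ℝ} {y : ℝ → E} {a t C : ℝ}
    (hA : Continuous A) (hm : ∀ s, HasDerivAt m ‖A s‖ s) (hma : m a = 0) (hC : 0 ≤ C)
    (hy : ∀ s, ‖y s‖ ≤ C) (hat : a ≤ t) :
    Real.exp (-(2 * m t)) * ‖∫ s in a..t, Real.exp (2 * m s) • A s (y s)‖ ≤ 1 / 2 * C := by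
  have hmc : Continuous m := continuous_iff_continuousAt.2 fun s => (hm s).continuousAt
  have hint : ∫ s in a..t, Real.exp (2 * m s) * ‖A s‖ * C
      = Real.exp (2 * m t) / 2 * C - 1 / 2 * C := by
    have := integral_eq_sub_of_hasDerivAt (a := a) (b := t)
      (f := fun s => Real.exp (2 * m s) / 2 * C) (f' := fun s => Real.exp (2 * m s) * ‖A s‖ * C)
      (fun s _ => by
        refine (((((hm s).const_mul 2).exp).div_const 2).mul_const C).congr_deriv ?_
        ring)
      (Continuous.intervalIntegrable (by fun_prop) _ _)
    rw [this, hma]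
    simp
  have hle : ‖∫ s in a..t, Real.exp (2 * m s) • A s (y s)‖
      ≤ ∫ s in a..t, Real.exp (2 * m s) * ‖A s‖ * C := by
    refine norm_integral_le_of_norm_le hat (Eventually.of_forall fun s _ => ?_)
      (Continuous.intervalIntegrable (by fun_prop) _ _)
    rw [norm_smul, Real.norm_of_nonneg (Real.exp_pos _).le, mul_assoc]
    gcongr
    exact (A s).le_opNorm_of_le (hy s)
  calc Real.exp (-(2 * m t)) * ‖∫ s in a..t, Real.exp (2 * m s) • A s (y s)‖
      ≤ Real.exp (-(2 * m t)) * (Real.exp (2 * m t) / 2 * C - 1 / 2 * C) := by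
        rw [← hint]
        gcongr
    _ ≤ Real.exp (-(2 * m t)) * (Real.exp (2 * m t) / 2 * C) := by
        gcongr
        linarith
    _ = 1 / 2 * C := by
        rw [Real.exp_neg]
        field_simp

/-- A linear differential equation with continuous coefficients is solvable on `[a, ∞)`. -/
theorem exists_forall_hasDerivAt_linear [CompleteSpace E] {A : ℝ → E →L[ℝ] E}
    (hA : Continuous A) (a : ℝ) (x₀ : E) :
    ∃ x : ℝ → E, x a = x₀ ∧ ∀ t, a ≤ t → HasDerivAt x (A t (x t)) t := by
  set m : ℝ → ℝ := fun t => ∫ s in a..t, ‖A s‖ with hm_def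
  have hm : ∀ s, HasDerivAt m ‖A s‖ s := fun s => hA.norm.integral_hasStrictDerivAt a s |>.hasDerivAt
  have hma : m a = 0 := by simp [hm_def]
  have hmc : Continuous m := continuous_iff_continuousAt.2 fun s => (hm s).continuousAt
  have hm0 : ∀ t, a ≤ t → 0 ≤ m t := fun t ht => integral_nonneg ht fun s _ => norm_nonneg _
  -- the integral operator, in the variable `exp (-2 m) • x`
  let I : (ℝ →ᵇ E) → ℝ → E := fun y t => ∫ s in a..t, Real.exp (2 * m s) • A s (y s)
  have hIint : ∀ (y : ℝ →ᵇ E), Continuous fun s => Real.exp (2 * m s) • A s (y s) :=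
    fun y => by have := y.continuous; fun_prop
  have hIderiv : ∀ (y : ℝ →ᵇ E) t, HasDerivAt (I y) (Real.exp (2 * m t) • A t (y t)) t :=
    fun y t => (hIint y).integral_hasStrictDerivAt a t |>.hasDerivAt
  have hIc : ∀ y, Continuous (I y) :=
    fun y => continuous_iff_continuousAt.2 fun t => (hIderiv y t).continuousAt
  let F : (ℝ →ᵇ E) → ℝ → E := fun y t =>
    Real.exp (-(2 * m (max a t))) • (x₀ + I y (max a t))
  let T : (ℝ →ᵇ E) → (ℝ →ᵇ E) := fun y =>
    BoundedContinuousFunction.ofNormedAddCommGroup (F y)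
      (by have := hIc y; fun_prop) (‖x₀‖ + 1 / 2 * ‖y‖) (fun t => by
        have h1 := exp_neg_mul_norm_integral_le hA hm hma (norm_nonneg y)
          (fun s => y.norm_coe_le_norm s) (le_max_left a t)
        have h2 : Real.exp (-(2 * m (max a t))) ≤ 1 :=
          Real.exp_le_one_iff.2 (by linarith [hm0 _ (le_max_left a t)])
        calc ‖F y t‖ = Real.exp (-(2 * m (max a t))) * ‖x₀ + I y (max a t)‖ := by
              rw [norm_smul, Real.norm_of_nonneg (Real.exp_pos _).le]
          _ ≤ Real.exp (-(2 * m (max a t))) * (‖x₀‖ + ‖I y (max a t)‖) := by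
              gcongr
              exact norm_add_le _ _
          _ ≤ ‖x₀‖ + 1 / 2 * ‖y‖ := by
              rw [mul_add]
              exact add_le_add (mul_le_of_le_one_left (norm_nonneg _) h2) h1)
  have hT : ContractingWith (1 / 2) T := by
    refine ⟨by rw [← NNReal.coe_lt_coe]; norm_num, LipschitzWith.of_dist_le_mul fun y z => ?_⟩
    rw [BoundedContinuousFunction.dist_le (by positivity)]
    intro t
    have h1 := exp_neg_mul_norm_integral_le (y := y - z) hA hm hma (norm_nonneg (y - z))
      (fun s => (y - z).norm_coe_le_norm s) (le_max_left a t)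
    have h2 : I y (max a t) - I z (max a t)
        = ∫ s in a..(max a t), Real.exp (2 * m s) • A s ((y - z) s) := by
      rw [← integral_sub ((hIint y).intervalIntegrable _ _) ((hIint z).intervalIntegrable _ _)]
      simp [smul_sub]
    calc dist (T y t) (T z t) = ‖F y t - F z t‖ := dist_eq_norm _ _
      _ = Real.exp (-(2 * m (max a t))) * ‖I y (max a t) - I z (max a t)‖ := by
          rw [← smul_sub, add_sub_add_left_eq_sub, norm_smul,
            Real.norm_of_nonneg (Real.exp_pos _).le]
      _ ≤ 1 / 2 * ‖y - z‖ := by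
          rw [h2]
          exact h1
      _ = _ := by simp [dist_eq_norm]
  obtain ⟨y, hy⟩ : ∃ y, T y = y := ⟨_, hT.fixedPoint_isFixedPt⟩
  refine ⟨fun t => x₀ + I y t, by simp [I], fun t ht => ?_⟩
  refine ((hIderiv y t).const_add x₀).congr_deriv ?_
  have hyt : y t = Real.exp (-(2 * m t)) • (x₀ + I y t) := by
    have : F y t = y t := congrArg (fun f : ℝ →ᵇ E => f t) hy
    simpa [F, max_eq_right ht] using this.symm
  rw [hyt, map_smul, smul_smul, ← Real.exp_add]
  simp

/-- A solution of a linear differential equation which vanishes at `b` vanishes before `b`. -/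
theorem eq_zero_of_hasDerivAt_linear_of_right_eq_zero {A : ℝ → E →L[ℝ] E} (hA : Continuous A)
    {a b : ℝ} (hab : a ≤ b) {x : ℝ → E} (hx : ∀ t ∈ Icc a b, HasDerivAt x (A t (x t)) t)
    (hb : x b = 0) : x a = 0 := by
  obtain ⟨K, hK⟩ := isCompact_Icc.exists_bound_of_continuousOn (hA.continuousOn (s := Icc a b))
  have hlip : ∀ t ∈ Ioc a b, LipschitzOnWith K.toNNReal (fun z => A t z) univ := fun t ht =>
    ((A t).lipschitz.weaken (by
      rw [← norm_toNNReal]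
      exact Real.toNNReal_le_toNNReal (hK t (Ioc_subset_Icc_self ht)))).lipschitzOnWith
  refine ODE_solution_unique_of_mem_Icc_left (v := fun t z => A t z) (g := fun _ => (0 : E)) hlip
    (fun t ht => (hx t ht).continuousAt.continuousWithinAt)
    (fun t ht => (hx t (Ioc_subset_Icc_self ht)).hasDerivWithinAt) (fun _ _ => mem_univ _)
    continuousOn_const (fun t _ => ?_) (fun _ _ => mem_univ _) hb (left_mem_Icc.2 hab)
  simpa using hasDerivWithinAt_const t (Iic t) (0 : E)

/-- A linear system for a pair of functions with values in a Banach algebra is solvable on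
`[a, ∞)`. -/
theorem exists_forall_hasDerivAt_linear_pair {R : Type*} [NormedRing R] [NormedAlgebra ℝ R]
    [CompleteSpace R] {B C D F : ℝ → R} (hB : Continuous B) (hC : Continuous C)
    (hD : Continuous D) (hF : Continuous F) (a : ℝ) (X₀ Y₀ : R) :
    ∃ X Y : ℝ → R, X a = X₀ ∧ Y a = Y₀ ∧
      (∀ t, a ≤ t → HasDerivAt X (B t * X t + C t * Y t) t) ∧
      ∀ t, a ≤ t → HasDerivAt Y (D t * X t + F t * Y t) t := by
  let L : R →L[ℝ] R →L[ℝ] R := ContinuousLinearMap.mul ℝ R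
  let π₁ : R × R →L[ℝ] R := ContinuousLinearMap.fst ℝ R R
  let π₂ : R × R →L[ℝ] R := ContinuousLinearMap.snd ℝ R R
  let A : ℝ → (R × R) →L[ℝ] (R × R) := fun t =>
    (ContinuousLinearMap.inl ℝ R R).comp ((L (B t)).comp π₁ + (L (C t)).comp π₂) +
    (ContinuousLinearMap.inr ℝ R R).comp ((L (D t)).comp π₁ + (L (F t)).comp π₂)
  have hA : Continuous A := by fun_prop
  obtain ⟨x, hx₀, hx⟩ := exists_forall_hasDerivAt_linear hA a (X₀, Y₀)
  refine ⟨fun t => (x t).1, fun t => (x t).2, by simp [hx₀], by simp [hx₀],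
    fun t ht => ?_, fun t ht => ?_⟩
  · exact (hasFDerivAt_fst.comp_hasDerivAt t (hx t ht)).congr_deriv (by simp [A, L, π₁, π₂])
  · exact (hasFDerivAt_snd.comp_hasDerivAt t (hx t ht)).congr_deriv (by simp [A, L, π₁, π₂])

end LinearODE

section Riccati

attribute [local instance] Matrix.linftyOpNormedRing Matrix.linftyOpNormedAlgebra

variable {n : ℕ}

local notation "𝕄" => Matrix (Fin n) (Fin n) ℂ

theorem HasDerivAt.matrix_conjTranspose {G : ℝ → 𝕄} {G' : 𝕄} {t : ℝ} (hG : HasDerivAt G G' t) :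
    HasDerivAt (fun s => (G s)ᴴ) G'ᴴ t := by
  let L : 𝕄 →ₗ[ℝ] 𝕄 := (starLinearEquiv ℝ (A := 𝕄)).toLinearMap
  exact (LinearMap.toContinuousLinearMap L).hasFDerivAt.comp_hasDerivAt t hG

theorem hasDerivAt_conjTranspose_mul {P Q S X Y : ℝ → 𝕄} {t : ℝ} (hP : (P t).IsHermitian)
    (hX : HasDerivAt X ((Q t)ᴴ * X t + P t * Y t) t)
    (hY : HasDerivAt Y (-(S t) * X t + -(Q t) * Y t) t) :
    HasDerivAt (fun s => (X s)ᴴ * Y s) ((Y t)ᴴ * P t * Y t + (X t)ᴴ * -(S t) * X t) t := by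
  refine (hX.matrix_conjTranspose.mul hY).congr_deriv ?_
  simp only [conjTranspose_add, conjTranspose_mul,
    conjTranspose_conjTranspose, hP.eq]
  noncomm_ring

theorem HasDerivAt.re_dotProduct_mulVec {G : ℝ → 𝕄} {G' : 𝕄} {t : ℝ} (hG : HasDerivAt G G' t)
    (v : Fin n → ℂ) :
    HasDerivAt (fun s => (star v ⬝ᵥ (G s *ᵥ v)).re) (star v ⬝ᵥ (G' *ᵥ v)).re t := by
  let L : 𝕄 →ₗ[ℝ] ℝ :=
    { toFun := fun M => (star v ⬝ᵥ (M *ᵥ v)).re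
      map_add' := fun M N => by simp [add_mulVec]
      map_smul' := fun c M => by simp [smul_mulVec] }
  exact (LinearMap.toContinuousLinearMap L).hasFDerivAt.comp_hasDerivAt t hG

theorem HasDerivAt.mulVec_const {G : ℝ → 𝕄} {G' : 𝕄} {t : ℝ} (hG : HasDerivAt G G' t)
    (v : Fin n → ℂ) : HasDerivAt (fun s => G s *ᵥ v) (G' *ᵥ v) t := by
  let L : 𝕄 →ₗ[ℝ] (Fin n → ℂ) :=
    { toFun := fun M => M *ᵥ v
      map_add' := fun M N => add_mulVec M N v
      map_smul' := fun c M => smul_mulVec c M v }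
  exact (LinearMap.toContinuousLinearMap L).hasFDerivAt.comp_hasDerivAt t hG

theorem HasDerivAt.matrix_apply {G : ℝ → 𝕄} {G' : 𝕄} {t : ℝ} (hG : HasDerivAt G G' t)
    (i j : Fin n) : HasDerivAt (fun s => G s i j) (G' i j) t :=
  (LinearMap.toContinuousLinearMap (Matrix.entryLinearMap ℝ ℂ i j)).hasFDerivAt.comp_hasDerivAt
    t hG

theorem monotoneOn_re_dotProduct_mulVec {G G' : ℝ → 𝕄} {a : ℝ}
    (hG : ∀ t, a ≤ t → HasDerivAt G (G' t) t) (hG' : ∀ t, a ≤ t → (G' t).PosSemidef)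
    (v : Fin n → ℂ) : MonotoneOn (fun s => (star v ⬝ᵥ (G s *ᵥ v)).re) (Ici a) := by
  refine monotoneOn_of_hasDerivWithinAt_nonneg (f' := fun t => (star v ⬝ᵥ (G' t *ᵥ v)).re)
    (convex_Ici a)
    (fun t ht => ((hG t ht).re_dotProduct_mulVec v).continuousAt.continuousWithinAt)
    (fun t ht => ((hG t (interior_subset ht)).re_dotProduct_mulVec v).hasDerivWithinAt)
    (fun t ht => (hG' t (interior_subset ht)).re_dotProduct_nonneg v)

/-- A differentiable matrix function which is positive semidefinite at the left end point and has
positive semidefinite derivative stays positive semidefinite. -/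
theorem posSemidef_of_hasDerivAt_posSemidef {G G' : ℝ → 𝕄} {a : ℝ}
    (hG : ∀ t, a ≤ t → HasDerivAt G (G' t) t) (hG' : ∀ t, a ≤ t → (G' t).PosSemidef)
    (ha : (G a).PosSemidef) {t : ℝ} (ht : a ≤ t) : (G t).PosSemidef := by
  have hherm : (G t).IsHermitian := by
    have hD : ∀ s, a ≤ s → HasDerivAt (fun s => (G s)ᴴ - G s) 0 s := fun s hs =>
      ((hG s hs).matrix_conjTranspose.sub (hG s hs)).congr_deriv
        (by rw [(hG' s hs).isHermitian.eq, sub_self])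
    have := constant_of_has_deriv_right_zero (a := a) (b := t)
      (fun s hs => (hD s hs.1).continuousAt.continuousWithinAt)
      (fun s hs => (hD s hs.1).hasDerivWithinAt) t (right_mem_Icc.2 ht)
    rw [ha.isHermitian.eq, sub_self] at this
    exact sub_eq_zero.1 this
  refine .of_dotProduct_mulVec_nonneg hherm fun v => ?_
  refine RCLike.nonneg_iff.2 ⟨?_, hherm.im_star_dotProduct_mulVec_self v⟩
  exact (ha.re_dotProduct_nonneg v).trans
    (monotoneOn_re_dotProduct_mulVec hG hG' v self_mem_Ici ht ht)

/-- If `X b *ᵥ v = 0`, then the monotone form `v* X* Y v` vanishes on `[a, b]`, hence `P Y v = 0` and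
`X v` solves a homogeneous linear equation. -/
theorem isUnit_of_hamiltonian {P Q S X Y : ℝ → 𝕄} {a : ℝ} (hQ : Continuous Q)
    (hP : ∀ t, (P t).PosSemidef) (hS : ∀ t, (-(S t)).PosSemidef)
    (hX : ∀ t, a ≤ t → HasDerivAt X ((Q t)ᴴ * X t + P t * Y t) t)
    (hY : ∀ t, a ≤ t → HasDerivAt Y (-(S t) * X t + -(Q t) * Y t) t)
    (hXa : X a = 1) (hYa : (Y a).PosSemidef) {b : ℝ} (hab : a ≤ b) : IsUnit (X b) := by
  rw [isUnit_iff_isUnit_det, isUnit_iff_ne_zero]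
  intro hdet
  obtain ⟨v, hv, hXv⟩ := exists_mulVec_eq_zero_iff.2 hdet
  have hG := fun t ht => hasDerivAt_conjTranspose_mul (hP t).isHermitian (hX t ht) (hY t ht)
  have hPY := fun t => (hP t).conjTranspose_mul_mul_same (Y t)
  have hSX := fun t => (hS t).conjTranspose_mul_mul_same (X t)
  have hmono := monotoneOn_re_dotProduct_mulVec hG (fun t _ => (hPY t).add (hSX t)) v
  set q : ℝ → ℝ := fun s => (star v ⬝ᵥ (((X s)ᴴ * Y s) *ᵥ v)).re with hq
  have hqb : q b = 0 := by
    simp [hq, ← mulVec_mulVec, dotProduct_mulVec, ← star_mulVec, hXv]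
  have hqa : 0 ≤ q a := by
    simpa [hq, hXa] using hYa.re_dotProduct_nonneg v
  have hq0 : ∀ t ∈ Icc a b, q t = 0 := fun t ht => le_antisymm
    (hqb ▸ hmono ht.1 hab ht.2) (hqa.trans (hmono self_mem_Ici ht.1 ht.1))
  rcases hab.eq_or_lt with rfl | hlt
  · exact hv (by simpa [hXa] using hXv)
  have hPYv : ∀ t ∈ Icc a b, P t *ᵥ (Y t *ᵥ v) = 0 := fun t ht => by
    have h1 := ((hG t ht.1).re_dotProduct_mulVec v).hasDerivWithinAt (s := Icc a b)
    have h2 : HasDerivWithinAt q 0 (Icc a b) t :=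
      (hasDerivWithinAt_const t (Icc a b) (0 : ℝ)).congr hq0 (hq0 t ht)
    have h3 := (uniqueDiffOn_Icc hlt t ht).eq_deriv _ h1 h2
    rw [add_mulVec, dotProduct_add, Complex.add_re] at h3
    have h4 : 0 ≤ (star v ⬝ᵥ (((Y t)ᴴ * P t * Y t) *ᵥ v)).re := (hPY t).re_dotProduct_nonneg v
    have h5 : 0 ≤ (star v ⬝ᵥ (((X t)ᴴ * -(S t) * X t) *ᵥ v)).re := (hSX t).re_dotProduct_nonneg v
    have h6 : star v ⬝ᵥ (((Y t)ᴴ * P t * Y t) *ᵥ v) = 0 :=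
      Complex.ext (by simp only [Complex.zero_re]; linarith)
        ((hPY t).isHermitian.im_star_dotProduct_mulVec_self v)
    rw [← (hP t).dotProduct_mulVec_zero_iff]
    rw [← h6]
    simp only [← mulVec_mulVec, dotProduct_mulVec, star_mulVec]
  let L : 𝕄 →L[ℝ] (Fin n → ℂ) →L[ℝ] (Fin n → ℂ) := LinearMap.toContinuousLinearMap
    { toFun := fun M => LinearMap.toContinuousLinearMap (M.mulVecLin.restrictScalars ℝ)
      map_add' := fun M N => by ext; simp
      map_smul' := fun c M => by ext; simp }
  have := eq_zero_of_hasDerivAt_linear_of_right_eq_zero (A := fun t => L (Q t)ᴴ)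
    (L.continuous.comp hQ.matrix_conjTranspose) hab (x := fun t => X t *ᵥ v)
    (fun t ht => ((hX t ht.1).mulVec_const v).congr_deriv (by
      simp [L, add_mulVec, ← mulVec_mulVec, hPYv t ht])) hXv
  exact hv (by simpa [hXa] using this)

theorem hasDerivAt_mul_inv_of_hamiltonian {P Q S X Y : ℝ → 𝕄} {t : ℝ}
    (hX : HasDerivAt X ((Q t)ᴴ * X t + P t * Y t) t)
    (hY : HasDerivAt Y (-(S t) * X t + -(Q t) * Y t) t) (hu : IsUnit (X t)) :
    HasDerivAt (fun s => Y s * (X s)⁻¹)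
      (-(Y t * (X t)⁻¹ * P t * (Y t * (X t)⁻¹) + Q t * (Y t * (X t)⁻¹)
        + Y t * (X t)⁻¹ * (Q t)ᴴ + S t)) t := by
  have hinv : HasDerivAt (fun s => (X s)⁻¹)
      (-((X t)⁻¹ * ((Q t)ᴴ * X t + P t * Y t) * (X t)⁻¹)) t := by
    simp only [nonsing_inv_eq_ringInverse]
    obtain ⟨u, hu⟩ := hu
    have h := hasFDerivAt_ringInverse (𝕜 := ℝ) u
    rw [hu] at h
    refine (h.comp_hasDerivAt t hX).congr_deriv ?_
    simp [← hu]
  refine (hY.mul hinv).congr_deriv ?_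
  have hXX : X t * (X t)⁻¹ = 1 := mul_nonsing_inv _ ((isUnit_iff_isUnit_det _).1 hu)
  have e1 : (-(S t) * X t + -(Q t) * Y t) * (X t)⁻¹ = -(S t) * (X t * (X t)⁻¹)
      - Q t * (Y t * (X t)⁻¹) := by noncomm_ring
  have e2 : Y t * -((X t)⁻¹ * ((Q t)ᴴ * X t + P t * Y t) * (X t)⁻¹)
      = -(Y t * (X t)⁻¹ * (Q t)ᴴ * (X t * (X t)⁻¹)) - Y t * (X t)⁻¹ * P t * (Y t * (X t)⁻¹) := by
    noncomm_ring
  rw [e1, e2, hXX]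
  noncomm_ring

theorem exists_riccati_solution {P Q S : ℝ → 𝕄} (hP : Continuous P) (hQ : Continuous Q)
    (hS : Continuous S) (hPpos : ∀ t, (P t).PosSemidef) (hSneg : ∀ t, (-(S t)).PosSemidef)
    (a : ℝ) {Z₀ : 𝕄} (hZ₀ : Z₀.PosSemidef) :
    ∃ Z : ℝ → 𝕄, Z a = Z₀ ∧
      (∀ t, a ≤ t → ∀ i j, HasDerivAt (fun s => Z s i j)
          ((-(Z t * P t * Z t + Q t * Z t + Z t * (Q t)ᴴ + S t)) i j) t) ∧
      ∀ t, a ≤ t → (Z t).PosSemidef := by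
  obtain ⟨X, Y, hXa, hYa, hX, hY⟩ :=
    @exists_forall_hasDerivAt_linear_pair 𝕄 _ _ (FiniteDimensional.complete ℝ _) _ _ _ _
      hQ.matrix_conjTranspose hP hS.neg hQ.neg a 1 Z₀
  have hu : ∀ t, a ≤ t → IsUnit (X t) := fun t ht =>
    isUnit_of_hamiltonian hQ hPpos hSneg hX hY hXa (hYa ▸ hZ₀) ht
  refine ⟨fun t => Y t * (X t)⁻¹, by simp [hXa, hYa], fun t ht i j =>
    (hasDerivAt_mul_inv_of_hamiltonian (hX t ht) (hY t ht) (hu t ht)).matrix_apply i j,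
    fun t ht => ?_⟩
  have hG : ((X t)ᴴ * Y t).PosSemidef := posSemidef_of_hasDerivAt_posSemidef
    (fun s hs => hasDerivAt_conjTranspose_mul (hPpos s).isHermitian (hX s hs) (hY s hs))
    (fun s _ => ((hPpos s).conjTranspose_mul_mul_same (Y s)).add
      ((hSneg s).conjTranspose_mul_mul_same (X s))) (by simpa [hXa, hYa] using hZ₀) ht
  have hXX : X t * (X t)⁻¹ = 1 := mul_nonsing_inv _ ((isUnit_iff_isUnit_det _).1 (hu t ht))
  have := hG.conjTranspose_mul_mul_same (X t)⁻¹
  rwa [← Matrix.mul_assoc, ← conjTranspose_mul, hXX, conjTranspose_one, Matrix.one_mul] at this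

end Riccati

/-- Global solvability of the symmetric Riccati equation
`Z' + Z P Z + Q Z + Z Q* + S = 0` with `P ≥ 0`, `S ≤ 0` and `Z(t₀) ≥ 0`:
the solution exists on all of `[t₀, ∞)` and stays Hermitian positive semidefinite. -/
theorem symmetric_riccati_global (n : ℕ) (t₀ : ℝ)
    (P Q S : ℝ → Matrix (Fin n) (Fin n) ℂ)
    (Z₀ : Matrix (Fin n) (Fin n) ℂ)
    (hP : ContinuousOn P (Set.Ici t₀)) (hQ : ContinuousOn Q (Set.Ici t₀))
    (hS : ContinuousOn S (Set.Ici t₀))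
    (hPpos : ∀ t, t₀ ≤ t → (P t).PosSemidef)
    (hSneg : ∀ t, t₀ ≤ t → (-(S t)).PosSemidef)
    (hZ₀ : Z₀.PosSemidef) :
    ∃ Z : ℝ → Matrix (Fin n) (Fin n) ℂ,
      Z t₀ = Z₀ ∧
      (∀ t ∈ Set.Ici t₀, ∀ i j,
        HasDerivAt (fun s => Z s i j)
          ((-(Z t * P t * Z t + Q t * Z t + Z t * (Q t)ᴴ + S t)) i j) t) ∧
      ∀ t ∈ Set.Ici t₀, (Z t).PosSemidef := by
  have hmax : Continuous fun t : ℝ => max t₀ t := by fun_prop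
  obtain ⟨Z, h0, hd, hp⟩ := exists_riccati_solution
    (P := fun t => P (max t₀ t)) (Q := fun t => Q (max t₀ t)) (S := fun t => S (max t₀ t))
    (hP.comp_continuous hmax fun t => le_max_left t₀ t)
    (hQ.comp_continuous hmax fun t => le_max_left t₀ t)
    (hS.comp_continuous hmax fun t => le_max_left t₀ t)
    (fun t => hPpos _ (le_max_left t₀ t)) (fun t => hSneg _ (le_max_left t₀ t)) t₀ hZ₀
  refine ⟨Z, h0, fun t ht i j => ?_, hp⟩
  simpa only [max_eq_right (mem_Ici.1 ht)] using hd t ht i j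
end
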